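/- Let a be a positive integer and let b_1 ≥ b_2 ≥ … ≥ b_a be a nonincreasing sequence of positive integers. There exists a co-polyunsaturated SGK graph G with independence number a such that Δω_k(G) = b_k for k = 1, …, a if and only if b_2 > b_3 > … > b_{a-1}. Moreover, G may be chosen so that both G and its complement are comparability graphs. -/

import Mathlib

/-- `s` is an independent set of the graph `G`. -/
def IndepSet {V : Type*} (G : SimpleGraph V) (s : Set V) : Prop :=
  ∀ ⦃v⦄, v ∈ s → ∀ ⦃w⦄, w ∈ s → ¬ G.Adj v w

/-- `α_k(G)`: the maximum number of vertices in a union of `k` independent sets. -/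
noncomputable def alphak {V : Type*} (G : SimpleGraph V) (k : ℕ) : ℕ :=
  sSup {n | ∃ A : Fin k → Set V, (∀ i, IndepSet G (A i)) ∧ (⋃ i, A i).ncard = n}

/-- `ω_k(G)`: the maximum number of vertices in a union of `k` cliques. -/
noncomputable def omegak {V : Type*} (G : SimpleGraph V) (k : ℕ) : ℕ :=
  sSup {n | ∃ A : Fin k → Set V, (∀ i, G.IsClique (A i)) ∧ (⋃ i, A i).ncard = n}

/-- The clique number `ω(G)`. -/
noncomputable def cliqueNumber {V : Type*} (G : SimpleGraph V) : ℕ :=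
  sSup {n | ∃ s : Set V, G.IsClique s ∧ s.ncard = n}

/-- The independence number `α(G)`. -/
noncomputable def indepNumber {V : Type*} (G : SimpleGraph V) : ℕ :=
  sSup {n | ∃ s : Set V, IndepSet G s ∧ s.ncard = n}

/-- `f` encodes a partition of the vertices of `G` into cliques:
its (nonempty) fibers are the cliques. -/
def IsCliquePartition {V : Type*} (G : SimpleGraph V) (f : V → V) : Prop :=
  ∀ i : V, G.IsClique (f ⁻¹' {i})

/-- The `k`-norm of the partition encoded by `f`: `Σ_C min (k, |C|)`. -/
noncomputable def knorm {V : Type*} [Fintype V] (f : V → V) (k : ℕ) : ℕ :=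
  ∑ i : V, min k (f ⁻¹' {i}).ncard

/-- `G` is a strong Greene–Kleitman (SGK) graph: every induced subgraph has, for every
positive `k`, a clique partition that is simultaneously `k`- and `k+1`-saturated. -/
def SGK {V : Type*} [Fintype V] (G : SimpleGraph V) : Prop :=
  ∀ (s : Finset V) (k : ℕ), 0 < k →
    ∃ f : (↑s : Set V) → (↑s : Set V),
      IsCliquePartition (G.induce ↑s) f ∧
      knorm f k = alphak (G.induce ↑s) k ∧
      knorm f (k + 1) = alphak (G.induce ↑s) (k + 1)

/-- An SGK graph is polyunsaturated if no clique partition is simultaneously `k`- and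
`l`-saturated for distinct nonconsecutive positive `k, l` below the clique number. -/
def PolyunsatG {V : Type*} [Fintype V] (G : SimpleGraph V) : Prop :=
  ∀ k l : ℕ, 0 < k → 0 < l → k < cliqueNumber G → l < cliqueNumber G →
    (k + 2 ≤ l ∨ l + 2 ≤ k) →
    ¬ ∃ f : V → V, IsCliquePartition G f ∧ knorm f k = alphak G k ∧ knorm f l = alphak G l

/-- `G` is a comparability graph: adjacency is comparability in some partial order. -/
def IsComparabilityGraph {V : Type*} (G : SimpleGraph V) : Prop :=
  ∃ r : V → V → Prop, IsPartialOrder V r ∧ ∀ v w, G.Adj v w ↔ (v ≠ w ∧ (r v w ∨ r w v))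

theorem ncard_eq_card_filter {V : Type*} [Fintype V] (s : Set V) [DecidablePred (· ∈ s)] :
    s.ncard = (Finset.univ.filter (· ∈ s)).card := by
  rw [← Set.ncard_coe_finset]; simp

theorem bddAbove_alphak {V : Type*} [Finite V] (G : SimpleGraph V) (k : ℕ) :
    BddAbove {n | ∃ A : Fin k → Set V, (∀ i, IndepSet G (A i)) ∧ (⋃ i, A i).ncard = n} := by
  refine ⟨Nat.card V, ?_⟩
  rintro n ⟨A, -, rfl⟩
  exact Set.ncard_le_card _

theorem le_alphak {V : Type*} [Finite V] {G : SimpleGraph V} {k : ℕ} (A : Fin k → Set V)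
    (hA : ∀ i, IndepSet G (A i)) : (⋃ i, A i).ncard ≤ alphak G k :=
  le_csSup (bddAbove_alphak G k) ⟨A, hA, rfl⟩

theorem alphak_le {V : Type*} {G : SimpleGraph V} {k N : ℕ}
    (h : ∀ A : Fin k → Set V, (∀ i, IndepSet G (A i)) → (⋃ i, A i).ncard ≤ N) :
    alphak G k ≤ N := by
  refine csSup_le ⟨_, fun _ => ∅, fun _ => by simp [IndepSet], rfl⟩ ?_
  rintro n ⟨A, hA, rfl⟩
  exact h A hA

/-- A clique meets a union of `k` independent sets in at most `k` vertices. -/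
theorem ncard_iUnion_inter_clique_le {V : Type*} [Finite V] {G : SimpleGraph V} {k : ℕ}
    {A : Fin k → Set V} (hA : ∀ i, IndepSet G (A i)) {K : Set V} (hK : G.IsClique K) :
    ((⋃ i, A i) ∩ K).ncard ≤ k := by
  have hex : ∀ x : V, x ∈ (⋃ i, A i) ∩ K → ∃ i, x ∈ A i := fun x hx => by simpa using hx.1
  rcases Nat.eq_zero_or_pos k with rfl | hk
  · simp
  have : Nonempty (Fin k) := ⟨⟨0, hk⟩⟩
  choose! g hg using hex
  have := Set.ncard_le_ncard_of_injOn (s := (⋃ i, A i) ∩ K) (t := (Set.univ : Set (Fin k))) g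
    (fun _ _ => Set.mem_univ _) (by
      intro x hx y hy hxy
      by_contra hne
      exact hA (g x) (hg x hx) (by rw [hxy]; exact hg y hy) (hK hx.2 hy.2 hne)) Set.finite_univ
  simpa [Set.ncard_univ] using this

theorem ncard_eq_sum_inter_fiber {V ι : Type*} [Fintype V] [Fintype ι] (f : V → ι) (s : Set V) :
    s.ncard = ∑ i, (s ∩ f ⁻¹' {i}).ncard := by
  classical
  rw [ncard_eq_card_filter, Finset.card_eq_sum_card_fiberwise (f := f) (t := Finset.univ)
    (fun _ _ => by simp)]
  refine Finset.sum_congr rfl fun i _ => ?_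
  rw [ncard_eq_card_filter, Finset.filter_filter]
  rfl

theorem alphak_le_knorm {V : Type*} [Fintype V] {G : SimpleGraph V} {f : V → V}
    (hf : IsCliquePartition G f) (k : ℕ) : alphak G k ≤ knorm f k := by
  refine alphak_le fun A hA => ?_
  rw [ncard_eq_sum_inter_fiber f, knorm]
  exact Finset.sum_le_sum fun i _ => le_min (ncard_iUnion_inter_clique_le hA (hf i))
    (Set.ncard_le_ncard Set.inter_subset_right)

/-- Feasible solutions of the dual of the weighted chain covering problem: chains cost `K`,
uncovered elements cost `c`. -/
structure DualFeasible {V : Type*} [PartialOrder V] (K c : ℤ) (u w : V → ℤ) : Prop where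
  le_top : ∀ x, u x ≤ K
  nonneg : ∀ x, 0 ≤ w x
  le_of_lt : ∀ x y, x < y → u x ≤ w y
  le_add : ∀ x, u x ≤ w x + c

theorem exists_optimal_dual {V : Type*} [PartialOrder V] [Fintype V] {K c : ℤ} (hK : 0 ≤ K)
    (hc : 0 ≤ c) : ∃ u w : V → ℤ, DualFeasible K c u w ∧
      ∀ u' w' : V → ℤ, DualFeasible K c u' w' → ∑ x, (u' x - w' x) ≤ ∑ x, (u x - w x) := by
  obtain ⟨m, ⟨u, w, h, rfl⟩, hm⟩ := Int.exists_greatest_of_bdd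
    (P := fun m => ∃ u w : V → ℤ, DualFeasible K c u w ∧ ∑ x, (u x - w x) = m)
    ⟨∑ _x : V, c, by
      rintro _ ⟨u, w, h, rfl⟩
      exact Finset.sum_le_sum fun x _ => by linarith [h.le_add x]⟩
    ⟨_, 0, 0, ⟨fun _ => hK, fun _ => le_rfl, fun _ _ _ => le_rfl, fun _ => by simpa using hc⟩, rfl⟩
  exact ⟨u, w, h, fun u' w' h' => hm _ ⟨u', w', h', rfl⟩⟩

/-- The pairs for which the dual constraint holds with equality. -/
def DualTight {V : Type*} [PartialOrder V] (c : ℤ) (u w : V → ℤ) (x y : V) : Prop :=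
  (x < y ∧ u x = w y) ∨ (x = y ∧ u x = w x + c)

/-- An optimal dual solution has a complementary partial matching along tight pairs. -/
theorem exists_complementary_matching {V : Type*} [PartialOrder V] [Fintype V] {K c : ℤ}
    {u w : V → ℤ} (h : DualFeasible K c u w)
    (hopt : ∀ u' w' : V → ℤ, DualFeasible K c u' w' → ∑ x, (u' x - w' x) ≤ ∑ x, (u x - w x)) :
    ∃ σ : V ⊕ V → V ⊕ V, Function.Injective σ ∧
      (∀ x y, σ (.inl x) = .inl y → DualTight c u w x y) ∧
      (∀ x y, σ (.inl x) = .inr y → u x = K) ∧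
      (∀ x y, σ (.inr x) = .inl y → w y = 0) := by
  classical
  let E : V ⊕ V → V ⊕ V → Prop := fun p q => match p, q with
    | .inl x, .inl y => DualTight c u w x y
    | .inl x, .inr _ => u x = K
    | .inr _, .inl y => w y = 0
    | .inr _, .inr _ => True
  obtain ⟨σ, hσ, hE⟩ :=
    (Fintype.all_card_le_filter_rel_iff_exists_injective E).mp (by
      intro S
      set N := Finset.univ.filter (fun q => ∃ p ∈ S, E p q) with hN
      rw [← Finset.card_toLeft_add_card_toRight (u := S),
        ← Finset.card_toLeft_add_card_toRight (u := N)]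
      have hNR : (∃ x ∈ S.toLeft, u x = K) ∨ S.toRight.Nonempty → N.toRight = Finset.univ := by
        intro hx
        ext y
        simp only [Finset.mem_toRight, hN, Finset.mem_filter, Finset.mem_univ, true_and, iff_true]
        rcases hx with ⟨x, hx, hu⟩ | ⟨x, hx⟩
        · exact ⟨.inl x, by simpa using hx, hu⟩
        · exact ⟨.inr x, by simpa using hx, trivial⟩
      have hsum : ∀ A B : Finset V, ∑ x, ((u x + if x ∈ A then 1 else 0) -
          (w x + if x ∈ B then 1 else 0)) = ∑ x, (u x - w x) + (A.card - B.card) := by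
        intro A B
        simp only [Finset.sum_sub_distrib, Finset.sum_add_distrib, Finset.sum_ite_mem,
          Finset.univ_inter, Finset.sum_const]
        simp only [nsmul_eq_mul, mul_one]
        ring
      have hT : ∀ x ∈ S.toLeft, ∀ y, DualTight c u w x y → y ∈ N.toLeft := by
        intro x hx y hxy
        simp only [Finset.mem_toLeft, hN, Finset.mem_filter, Finset.mem_univ, true_and]
        exact ⟨.inl x, by simpa using hx, hxy⟩
      by_cases hB : S.toRight.Nonempty
      · have hW : ∀ y, w y = 0 → y ∈ N.toLeft := by
          intro y hy
          obtain ⟨x, hx⟩ := hB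
          simp only [Finset.mem_toLeft, hN, Finset.mem_filter, Finset.mem_univ, true_and]
          exact ⟨.inr x, by simpa using hx, hy⟩
        have key := hopt (fun x => u x - 1 + if x ∈ S.toLeft then 1 else 0)
          (fun x => w x - 1 + if x ∈ N.toLeft then 1 else 0) (by
            have h1 := h.le_top
            have h2 := h.nonneg
            have h3 := h.le_of_lt
            have h4 := h.le_add
            refine ⟨fun x => ?_, fun x => ?_, fun x y hxy => ?_, fun x => ?_⟩
            · have := h1 x
              split_ifs <;> omega
            · have := h2 x
              have := hW x
              split_ifs with hx <;> grind
            · have := h3 x y hxy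
              have := fun hx => hT x hx y
              have : u x = w y → DualTight c u w x y := fun e => .inl ⟨hxy, e⟩
              grind
            · have := h4 x
              have := fun hx => hT x hx x
              have : u x = w x + c → DualTight c u w x x := fun e => .inr ⟨rfl, e⟩
              grind)
        have e := hsum S.toLeft N.toLeft
        have e2 : ∑ x, ((u x - 1 + if x ∈ S.toLeft then 1 else 0) -
          (w x - 1 + if x ∈ N.toLeft then 1 else 0)) = ∑ x, ((u x + if x ∈ S.toLeft then 1 else 0) -
          (w x + if x ∈ N.toLeft then 1 else 0)) := Finset.sum_congr rfl fun x _ => by ring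
        have := Finset.card_le_univ S.toRight
        rw [hNR (.inr hB), Finset.card_univ]
        beta_reduce at key
        omega
      · rw [Finset.not_nonempty_iff_eq_empty] at hB
        rw [hB, Finset.card_empty]
        by_cases hA : ∃ x ∈ S.toLeft, u x = K
        · have := Finset.card_le_univ S.toLeft
          rw [hNR (.inl hA), Finset.card_univ]
          omega
        · push Not at hA
          have key := hopt (fun x => u x + if x ∈ S.toLeft then 1 else 0)
            (fun x => w x + if x ∈ N.toLeft then 1 else 0) (by
              have h1 := h.le_top
              have h2 := h.nonneg
              have h3 := h.le_of_lt
              have h4 := h.le_add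
              refine ⟨fun x => ?_, fun x => ?_, fun x y hxy => ?_, fun x => ?_⟩
              · have := h1 x
                have := hA x
                grind
              · have := h2 x
                split_ifs with hx <;> grind
              · have := h3 x y hxy
                have := fun hx => hT x hx y
                have : u x = w y → DualTight c u w x y := fun e => .inl ⟨hxy, e⟩
                grind
              · have := h4 x
                have := fun hx => hT x hx x
                have : u x = w x + c → DualTight c u w x x := fun e => .inr ⟨rfl, e⟩
                grind)
          have e := hsum S.toLeft N.toLeft
          beta_reduce at key
          omega)
  refine ⟨σ, hσ, fun x y hxy => ?_, fun x y hxy => ?_, fun x y hxy => ?_⟩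
  · have := hE (.inl x); rw [hxy] at this; exact this
  · have := hE (.inl x); rw [hxy] at this; exact this
  · have := hE (.inr x); rw [hxy] at this; exact this

/-- A partial matching along comparable pairs links the elements into chains. -/
theorem exists_chain_partition_of_matching {V : Type*} [PartialOrder V] [Fintype V] [DecidableEq V]
    {G : SimpleGraph V} (hG : ∀ x y, G.Adj x y ↔ x < y ∨ y < x) (σ : V → Option V)
    (hσ : ∀ x y z, σ x = some z → σ y = some z → x = y) (hle : ∀ x y, σ x = some y → x ≤ y) :
    ∃ f : V → V, IsCliquePartition G f ∧ ∀ k : ℕ,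
      (knorm f k : ℤ) ≤
        ∑ x, if σ x = some x then (1 : ℤ) else if σ x = none then (k : ℤ) else 0 := by
  let R : V → V → Prop := fun x y => σ x = some y
  have hex : ∀ x, ∃ t, Relation.ReflTransGen R x t ∧ (σ t = none ∨ σ t = some t) := by
    intro x
    induction x using (wellFounded_gt (α := V)).induction with
    | _ x ih =>
      rcases hx : σ x with _ | y
      · exact ⟨x, .refl, .inl hx⟩
      · rcases (hle x y hx).eq_or_lt with rfl | hlt
        · exact ⟨x, .refl, .inr hx⟩
        · obtain ⟨t, ht, h⟩ := ih y hlt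
          exact ⟨t, .head hx ht, h⟩
  choose f hf hft using hex
  have hRle : ∀ x y, Relation.ReflTransGen R x y → x ≤ y := by
    intro x y h
    induction h with
    | refl => exact le_rfl
    | tail _ h ih => exact ih.trans (hle _ _ h)
  have hU : Relator.RightUnique (Function.swap R) := fun x y z hy hz => hσ y z x hy hz
  refine ⟨f, ?_, fun k => ?_⟩
  · rintro i x rfl y hy hne
    rw [hG]
    have hy : f y = f x := hy
    have h1 := (Relation.reflTransGen_swap (r := R)).mpr (hf x)
    have h2 := (Relation.reflTransGen_swap (r := R)).mpr (hf y)
    rw [hy] at h2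
    rcases Relation.ReflTransGen.total_of_right_unique hU h1 h2 with h | h
    · exact .inr ((hRle _ _ (Relation.reflTransGen_swap.mp h)).lt_of_ne hne.symm)
    · exact .inl ((hRle _ _ (Relation.reflTransGen_swap.mp h)).lt_of_ne hne)
  · rw [knorm]
    push_cast
    refine Finset.sum_le_sum fun i _ => ?_
    split_ifs with h1 h2
    · have : f ⁻¹' {i} ⊆ {i} := by
        rintro x rfl
        have : ∀ t, Relation.ReflTransGen R x t → σ t = some t → x = t := by
          intro t ht
          induction ht with
          | refl => exact fun _ => rfl
          | tail _ h ih =>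
            intro htt
            have := hσ _ _ _ h htt
            subst this
            exact ih htt
        exact this _ (hf x) h1
      have := Set.ncard_le_ncard this
      simp only [Set.ncard_singleton] at this
      omega
    · exact min_le_left _ _
    · have : f ⁻¹' {i} = ∅ := by
        ext x
        simp only [Set.mem_preimage, Set.mem_singleton_iff, Set.mem_empty_iff_false, iff_false]
        rintro rfl
        have := hft x
        tauto
      simp [this]

/-- A dual solution with unit costs yields a family of antichains of at least its value. -/
theorem DualFeasible.sum_le_alphak {V : Type*} [PartialOrder V] [Fintype V]
    {G : SimpleGraph V} (hG : ∀ x y, G.Adj x y ↔ x < y ∨ y < x) {k : ℕ} {u w : V → ℤ}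
    (h : DualFeasible k 1 u w) : ∑ x, (u x - w x) ≤ alphak G k := by
  classical
  let A : Fin k → Set V := fun i => {x | u x = w x + 1 ∧ w x = (i : ℕ)}
  have hA : ∀ i, IndepSet G (A i) := by
    rintro i x ⟨hx, hx'⟩ y ⟨hy, hy'⟩ hxy
    rcases (hG x y).mp hxy with hlt | hlt
    · have := h.le_of_lt _ _ hlt
      omega
    · have := h.le_of_lt _ _ hlt
      omega
  have hAu : (⋃ i, A i) = {x | u x = w x + 1} := by
    ext x
    simp only [Set.mem_iUnion, Set.mem_ofPred_eq, A]
    refine ⟨fun ⟨_, hx, _⟩ => hx, fun hx => ?_⟩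
    have h1 := h.le_top x
    have h2 := h.nonneg x
    exact ⟨⟨(w x).toNat, by omega⟩, hx, by simp; omega⟩
  have hle := le_alphak A hA
  rw [hAu, ncard_eq_card_filter] at hle
  refine le_trans ?_ (Int.ofNat_le.mpr hle)
  rw [Finset.card_filter]
  push_cast
  refine Finset.sum_le_sum fun x _ => ?_
  have := h.le_add x
  simp only [Set.mem_ofPred_eq]
  split_ifs <;> omega

/-- The Greene–Kleitman theorem. -/
theorem exists_saturated_chain_partition {V : Type*} [PartialOrder V] [Fintype V]
    {G : SimpleGraph V} (hG : ∀ x y, G.Adj x y ↔ x < y ∨ y < x) (k : ℕ) :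
    ∃ f : V → V, IsCliquePartition G f ∧ knorm f k = alphak G k ∧
      knorm f (k + 1) = alphak G (k + 1) := by
  classical
  obtain ⟨u, w, h, hopt⟩ := exists_optimal_dual (V := V) (K := 2 * k + 1) (c := 2)
    (by positivity) (by norm_num)
  obtain ⟨τ, hτ, h1, h2, h3⟩ := exists_complementary_matching h hopt
  let σ : V → Option V := fun x => (τ (.inl x)).getLeft?
  have hσ : ∀ x y, σ x = some y ↔ τ (.inl x) = .inl y := by
    intro x y
    simp [σ, Sum.getLeft?_eq_some_iff]
  have hcost : ∑ x, (u x - w x) =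
      ∑ x, if σ x = some x then (2 : ℤ) else if σ x = none then (2 * k + 1 : ℤ) else 0 := by
    have e1 : ∑ z, Sum.elim w (fun _ : V => 0) (τ z) = ∑ z, Sum.elim w (fun _ : V => 0) z :=
      (Function.Injective.bijective_of_finite hτ).sum_comp _
    have e2 : ∑ z, (Sum.elim u (fun _ : V => 0) z - Sum.elim w (fun _ : V => 0) (τ z)) =
        ∑ x, (u x - w x) := by
      rw [Finset.sum_sub_distrib, e1, Finset.sum_sub_distrib]
      simp
    rw [← e2, Fintype.sum_sum_type]
    have e3 : ∑ x : V, (Sum.elim u (fun _ : V => 0) (.inr x) -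
        Sum.elim w (fun _ : V => 0) (τ (.inr x))) = 0 := by
      refine Finset.sum_eq_zero fun x _ => ?_
      rcases hx : τ (.inr x) with y | y
      · simp [h3 _ _ hx]
      · simp
    rw [e3, add_zero]
    refine Finset.sum_congr rfl fun x _ => ?_
    rcases hx : τ (.inl x) with y | y
    · have hy := (hσ x y).mpr hx
      rw [hy]
      rcases h1 _ _ hx with ⟨hlt, e⟩ | ⟨rfl, e⟩
      · simp [hlt.ne', e]
      · simp [e]
    · have hy : σ x = none := by simp [σ, hx]
      simp [hy, h2 _ _ hx]
  obtain ⟨f, hf, hk⟩ := exists_chain_partition_of_matching hG σ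
    (fun x y z hx hy => Sum.inl_injective (hτ (((hσ x z).mp hx).trans ((hσ y z).mp hy).symm)))
    (fun x y hx => by
      rcases h1 _ _ ((hσ x y).mp hx) with ⟨hlt, -⟩ | ⟨rfl, -⟩
      · exact hlt.le
      · exact le_rfl)
  have d1 : DualFeasible (k : ℕ) 1 (fun x => u x / 2) (fun x => w x / 2) :=
    ⟨fun x => by have := h.le_top x; omega, fun x => by have := h.nonneg x; omega,
      fun x y hxy => by have := h.le_of_lt x y hxy; omega,
      fun x => by have := h.le_add x; omega⟩
  have d2 : DualFeasible ((k + 1 : ℕ) : ℤ) 1 (fun x => (u x + 1) / 2) (fun x => (w x + 1) / 2) :=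
    ⟨fun x => by have := h.le_top x; push_cast; omega, fun x => by have := h.nonneg x; omega,
      fun x y hxy => by have := h.le_of_lt x y hxy; omega,
      fun x => by have := h.le_add x; omega⟩
  have l1 := d1.sum_le_alphak hG
  have l2 := d2.sum_le_alphak hG
  have l3 : ∑ x, (u x / 2 - w x / 2) + ∑ x, ((u x + 1) / 2 - (w x + 1) / 2) =
      ∑ x, (u x - w x) := by
    rw [← Finset.sum_add_distrib]
    exact Finset.sum_congr rfl fun x _ => by omega
  have m1 := hk k
  have m2 := hk (k + 1)
  have m3 : ∑ x, (if σ x = some x then (1 : ℤ) else if σ x = none then (k : ℤ) else 0) +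
      ∑ x, (if σ x = some x then (1 : ℤ) else if σ x = none then ((k + 1 : ℕ) : ℤ) else 0) =
      ∑ x, (u x - w x) := by
    rw [hcost, ← Finset.sum_add_distrib]
    refine Finset.sum_congr rfl fun x _ => ?_
    push_cast
    split_ifs <;> ring
  have n1 := alphak_le_knorm hf k
  have n2 := alphak_le_knorm hf (k + 1)
  refine ⟨f, hf, ?_, ?_⟩ <;> omega

theorem IsComparabilityGraph.sgk {V : Type*} [Fintype V] {G : SimpleGraph V}
    (hG : IsComparabilityGraph G) : SGK G := by
  obtain ⟨r, hr, hadj⟩ := hG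
  intro s k _
  let P : PartialOrder (↑s : Set V) :=
    { le := fun x y => r x y
      le_refl := fun x => hr.refl _
      le_trans := fun x y z => hr.trans _ _ _
      le_antisymm := fun x y h1 h2 => Subtype.ext (hr.antisymm _ _ h1 h2) }
  refine exists_saturated_chain_partition (fun x y => ?_) k
  rw [SimpleGraph.comap_adj, hadj, lt_iff_le_and_ne, lt_iff_le_and_ne]
  have e1 : x ≤ y ↔ r x y := Iff.rfl
  have e2 : y ≤ x ↔ r y x := Iff.rfl
  rw [e1, e2]
  simp only [Function.Embedding.subtype_apply, ne_eq, Subtype.ext_iff]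
  grind

/-- A vertex partition into cliques such that each class containing a colour `≥ k` contains all
colours `< k`. -/
structure IsRainbowPartition {V ι : Type*} (H : SimpleGraph V) (col : V → ℕ) (k : ℕ)
    (f : V → ι) : Prop where
  isClique : ∀ v w, f v = f w → v ≠ w → H.Adj v w
  rainbow : ∀ v, k ≤ col v → ∀ j < k, ∃ w, f w = f v ∧ col w = j

theorem le_ncard_of_colors {V : Type*} [Finite V] {col : V → ℕ} {k : ℕ} {s : Set V}
    (h : ∀ j < k, ∃ w ∈ s, col w = j) : k ≤ s.ncard := by
  have : Set.Iio k ⊆ col '' s := fun j hj => h j hj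
  calc k = (Set.Iio k).ncard := by simp [← Finset.coe_Iio, Set.ncard_coe_finset]
    _ ≤ (col '' s).ncard := Set.ncard_le_ncard this
    _ ≤ s.ncard := Set.ncard_image_le

theorem injOn_color_of_isClique {V : Type*} {H : SimpleGraph V} {col : V → ℕ}
    (hcol : ∀ v w, H.Adj v w → col v ≠ col w) {K : Set V} (hK : H.IsClique K) :
    Set.InjOn col K := by
  intro x hx y hy hxy
  by_contra hne
  exact hcol x y (hK hx hy hne) hxy

theorem ncard_clique_color_lt_le {V : Type*} [Finite V] {H : SimpleGraph V} {col : V → ℕ}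
    (hcol : ∀ v w, H.Adj v w → col v ≠ col w) {K : Set V} (hK : H.IsClique K) (k : ℕ) :
    ({v | col v < k} ∩ K).ncard ≤ k := by
  calc ({v | col v < k} ∩ K).ncard ≤ (Set.Iio k).ncard :=
        Set.ncard_le_ncard_of_injOn col (fun v hv => hv.1)
          ((injOn_color_of_isClique hcol hK).mono Set.inter_subset_right) (Set.finite_Iio k)
    _ = k := by simp [← Finset.coe_Iio, Set.ncard_coe_finset]

theorem IsRainbowPartition.alphak_eq {V ι : Type*} [Fintype V] {H : SimpleGraph V} {col : V → ℕ}
    (hcol : ∀ v w, H.Adj v w → col v ≠ col w) {k : ℕ} {f : V → ι}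
    (hf : IsRainbowPartition H col k f) : alphak H k = {v | col v < k}.ncard := by
  classical
  apply le_antisymm
  · refine alphak_le fun A hA => ?_
    rw [ncard_eq_sum_inter_fiber (Set.rangeFactorization f),
      ncard_eq_sum_inter_fiber (Set.rangeFactorization f) {v | col v < k}]
    refine Finset.sum_le_sum fun i _ => ?_
    have hK : H.IsClique (Set.rangeFactorization f ⁻¹' {i}) := by
      rintro v rfl w hw hne
      exact hf.isClique v w (congrArg Subtype.val hw).symm hne
    by_cases hex : ∃ v, Set.rangeFactorization f v = i ∧ k ≤ col v
    · obtain ⟨v, rfl, hv⟩ := hex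
      refine (ncard_iUnion_inter_clique_le hA hK).trans (le_ncard_of_colors (col := col) ?_)
      intro j hj
      obtain ⟨w, hw, rfl⟩ := hf.rainbow v hv j hj
      exact ⟨w, ⟨hj, Subtype.ext hw⟩, rfl⟩
    · push Not at hex
      exact Set.ncard_le_ncard fun v hv => ⟨hex v hv.2, hv.2⟩
  · have := le_alphak (G := H) (fun i : Fin k => {v | col v = i}) (fun i v hv w hw hvw =>
      hcol v w hvw (hv.trans hw.symm))
    refine le_trans (Set.ncard_le_ncard ?_) this
    intro v hv
    exact Set.mem_iUnion.mpr ⟨⟨col v, hv⟩, rfl⟩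

/-- In a saturated partition the classes containing colours `≥ k` contain all colours `< k`. -/
theorem isRainbowPartition_of_saturated {V : Type*} [Fintype V] {H : SimpleGraph V} {col : V → ℕ}
    (hcol : ∀ v w, H.Adj v w → col v ≠ col w) {k : ℕ} {f : V → V} (hf : IsCliquePartition H f)
    (hk : knorm f k = {v | col v < k}.ncard) : IsRainbowPartition H col k f := by
  refine ⟨fun v w h hne => hf (f w) h rfl hne, fun v hv j hj => ?_⟩
  rw [ncard_eq_sum_inter_fiber f, knorm, eq_comm] at hk
  have hle : ∀ i ∈ Finset.univ, ({v | col v < k} ∩ f ⁻¹' {i}).ncard ≤ min k (f ⁻¹' {i}).ncard :=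
    fun i _ => le_min (ncard_clique_color_lt_le hcol (hf i) k)
      (Set.ncard_le_ncard Set.inter_subset_right)
  have heq := (Finset.sum_eq_sum_iff_of_le hle).mp hk (f v) (Finset.mem_univ _)
  have hlt : ({v | col v < k} ∩ f ⁻¹' {f v}).ncard < (f ⁻¹' {f v}).ncard := by
    refine Set.ncard_lt_ncard ⟨Set.inter_subset_right, fun h => ?_⟩
    have : col v < k := (h (show v ∈ f ⁻¹' {f v} from rfl)).1
    omega
  have hcard : ({v | col v < k} ∩ f ⁻¹' {f v}).ncard = k := by omega
  have himg : col '' ({v | col v < k} ∩ f ⁻¹' {f v}) = Set.Iio k := by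
    refine Set.eq_of_subset_of_ncard_le ?_ ?_ (Set.finite_Iio k)
    · rintro _ ⟨x, hx, rfl⟩
      exact hx.1
    · rw [((injOn_color_of_isClique hcol (hf (f v))).mono
        Set.inter_subset_right).ncard_image, hcard]
      simp [← Finset.coe_Iio, Set.ncard_coe_finset]
  have : j ∈ col '' ({v | col v < k} ∩ f ⁻¹' {f v}) := by rw [himg]; exact hj
  obtain ⟨w, hw, rfl⟩ := this
  exact ⟨w, hw.2, rfl⟩

theorem cliqueNumber_eq {V : Type*} [Finite V] {H : SimpleGraph V} {a : ℕ}
    (hle : ∀ K, H.IsClique K → K.ncard ≤ a) {K : Set V} (hK : H.IsClique K) (ha : a ≤ K.ncard) :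
    cliqueNumber H = a := by
  apply le_antisymm
  · refine csSup_le ⟨_, K, hK, rfl⟩ ?_
    rintro _ ⟨s, hs, rfl⟩
    exact hle s hs
  · refine ha.trans (le_csSup ⟨a, ?_⟩ ⟨K, hK, rfl⟩)
    rintro _ ⟨s, hs, rfl⟩
    exact hle s hs

theorem IsRainbowPartition.cliqueNumber_eq {V ι : Type*} [Fintype V] {H : SimpleGraph V}
    {col : V → ℕ} (hcol : ∀ v w, H.Adj v w → col v ≠ col w) {a : ℕ} (hlt : ∀ v, col v < a)
    {f : V → ι} (hf : IsRainbowPartition H col (a - 1) f) (hv : ∃ v, col v = a - 1) :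
    cliqueNumber H = a := by
  obtain ⟨v, hv⟩ := hv
  refine _root_.cliqueNumber_eq (fun K hK => ?_) (K := {w | f w = f v})
    (fun x hx y hy hne => hf.isClique x y (hx.trans hy.symm) hne) (le_ncard_of_colors (col := col) ?_)
  · have := ncard_clique_color_lt_le hcol hK a
    exact (Set.ncard_le_ncard (t := {v | col v < a} ∩ K) fun v hv => ⟨hlt v, hv⟩).trans this
  · intro j hj
    rcases Nat.lt_or_ge j (a - 1) with h | h
    · exact hf.rainbow v hv.ge j h
    · exact ⟨v, rfl, by omega⟩

theorem isClique_compl_iff_indepSet {V : Type*} {G : SimpleGraph V} {s : Set V} :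
    Gᶜ.IsClique s ↔ IndepSet G s := by
  refine ⟨fun h v hv w hw hvw => ?_, fun h v hv w hw hne => ?_⟩
  · exact ((SimpleGraph.compl_adj G v w).mp (h hv hw hvw.ne)).2 hvw
  · exact (SimpleGraph.compl_adj G v w).mpr ⟨hne, h hv hw⟩

theorem isClique_iff_indepSet_compl {V : Type*} {G : SimpleGraph V} {s : Set V} :
    G.IsClique s ↔ IndepSet Gᶜ s := by
  rw [← isClique_compl_iff_indepSet, compl_compl]

theorem alphak_compl {V : Type*} (G : SimpleGraph V) (k : ℕ) : alphak Gᶜ k = omegak G k := by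
  simp only [alphak, omegak, isClique_iff_indepSet_compl]

theorem cliqueNumber_compl {V : Type*} (G : SimpleGraph V) :
    cliqueNumber Gᶜ = indepNumber G := by
  simp only [cliqueNumber, indepNumber, isClique_compl_iff_indepSet]

theorem knorm_succ {V : Type*} [Fintype V] (f : V → V) (k : ℕ) :
    knorm f (k + 1) = knorm f k + {i | k < (f ⁻¹' {i}).ncard}.ncard := by
  classical
  rw [ncard_eq_card_filter, Finset.card_filter, knorm, knorm, ← Finset.sum_add_distrib]
  refine Finset.sum_congr rfl fun i _ => ?_
  simp only [Set.mem_ofPred_eq]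
  split_ifs <;> omega

/-- A Greene–Kleitman partition is saturated three times in a row when two consecutive
differences agree. -/
theorem saturated_pred_of_alphak {V : Type*} [Fintype V] {H : SimpleGraph V} {f : V → V}
    (hf : IsCliquePartition H f) {k c c' : ℕ} (hc : c ≤ c')
    (h1 : alphak H (k + 1) = alphak H k + c) (h2 : alphak H (k + 2) = alphak H (k + 1) + c')
    (hk : knorm f (k + 1) = alphak H (k + 1)) (hk' : knorm f (k + 2) = alphak H (k + 2)) :
    knorm f k = alphak H k := by
  have n1 := knorm_succ f k
  have n2 : knorm f (k + 2) = _ := knorm_succ f (k + 1)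
  have hle := alphak_le_knorm hf k
  have hmono : {i | k + 1 < (f ⁻¹' {i}).ncard}.ncard ≤ {i | k < (f ⁻¹' {i}).ncard}.ncard :=
    Set.ncard_le_ncard fun i (hi : k + 1 < _) => (by omega : k < _)
  omega

theorem alphak_le_of_iso {V W : Type*} [Finite W] {G : SimpleGraph V} {H : SimpleGraph W}
    (e : G ≃g H) (k : ℕ) : alphak G k ≤ alphak H k := by
  refine alphak_le fun A hA => ?_
  have := le_alphak (G := H) (fun i => e '' A i) (by
    rintro i _ ⟨v, hv, rfl⟩ _ ⟨w, hw, rfl⟩ hvw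
    exact hA i hv hw (e.map_adj_iff.mp hvw))
  rwa [← Set.image_iUnion, Set.ncard_image_of_injective _ e.injective] at this

theorem alphak_eq_of_iso {V W : Type*} [Finite V] [Finite W] {G : SimpleGraph V}
    {H : SimpleGraph W} (e : G ≃g H) (k : ℕ) : alphak G k = alphak H k :=
  (alphak_le_of_iso e k).antisymm (alphak_le_of_iso e.symm k)

theorem knorm_conj {V W : Type*} [Fintype V] [Fintype W] (e : V ≃ W) (f : W → W) (k : ℕ) :
    knorm (e.symm ∘ f ∘ e) k = knorm f k := by
  rw [knorm, knorm, ← e.sum_comp]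
  refine Finset.sum_congr rfl fun v _ => ?_
  have : e.symm ∘ f ∘ e ⁻¹' {v} = e ⁻¹' (f ⁻¹' {e v}) := by
    ext x
    simp [Equiv.symm_apply_eq]
  rw [this, ← Equiv.image_symm_eq_preimage, Set.ncard_image_of_injective _ e.symm.injective]

theorem SGK.exists_saturated {V : Type*} [Fintype V] {H : SimpleGraph V} (hH : SGK H) {k : ℕ}
    (hk : 0 < k) : ∃ f : V → V, IsCliquePartition H f ∧ knorm f k = alphak H k ∧
      knorm f (k + 1) = alphak H (k + 1) := by
  obtain ⟨f, hf, h1, h2⟩ := hH Finset.univ k hk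
  let e : H ≃g H.induce (↑(Finset.univ : Finset V) : Set V) :=
    { toFun := fun v => ⟨v, by simp⟩
      invFun := Subtype.val
      left_inv := fun _ => rfl
      right_inv := fun _ => rfl
      map_rel_iff' := Iff.rfl }
  refine ⟨e.toEquiv.symm ∘ f ∘ e.toEquiv, ?_, ?_, ?_⟩
  · intro i x hx y hy hne
    have hx : f (e x) = e i := by simpa [Equiv.symm_apply_eq] using hx
    have hy : f (e y) = e i := by simpa [Equiv.symm_apply_eq] using hy
    exact e.map_adj_iff.mp (hf (e i) hx hy (e.injective.ne hne))
  · rw [knorm_conj, h1, alphak_eq_of_iso e]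
  · rw [knorm_conj, h2, alphak_eq_of_iso e]

theorem lt_of_polyunsatG {V : Type*} [Fintype V] {H : SimpleGraph V} (hH : SGK H)
    (hpoly : PolyunsatG H) {k c c' : ℕ} (hk : 0 < k) (hka : k + 2 < cliqueNumber H)
    (h1 : alphak H (k + 1) = alphak H k + c) (h2 : alphak H (k + 2) = alphak H (k + 1) + c') :
    c' < c := by
  by_contra! hc
  obtain ⟨f, hf, e1, e2⟩ := hH.exists_saturated (Nat.succ_pos k)
  exact hpoly k (k + 2) hk (by omega) (by omega) hka (.inl le_rfl)
    ⟨f, hf, saturated_pred_of_alphak hf hc h1 h2 e1 e2, e2⟩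

/-- The elements `(m, j)` (level, colour) of the caterpillar poset: the level `m < h` carries the
colours `0, …, m` and `m + 2` (and colour `1`); the colour `j` occurs in `e j` further levels. -/
def IsCell (a h : ℕ) (e : ℕ → ℕ) (p : ℕ × ℕ) : Prop :=
  p.2 < a ∧ ((p.1 < h ∧ (p.2 ≤ 1 ∨ p.2 ≤ p.1 ∨ p.2 = p.1 + 2)) ∨ (h ≤ p.1 ∧ p.1 < h + e p.2))

/-- The position of a cell in its level: first the foot, then the spine element `(m, m + 2)`,
then the tail by decreasing colour. -/
def cellKey (a : ℕ) (p : ℕ × ℕ) : ℕ :=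
  if p.2 = 0 then 0 else if p.2 = p.1 + 2 then 1 else a + 2 - p.2

/-- The strict relations of the caterpillar poset between different levels. -/
def CrossLT (a h : ℕ) (p q : ℕ × ℕ) : Prop :=
  q.1 < p.1 ∧ p.1 < h ∧ cellKey a p ≤ 1 ∧ 1 ≤ cellKey a q

/-- The order of the caterpillar poset. -/
def CellLE (a h : ℕ) (p q : ℕ × ℕ) : Prop :=
  (p.1 = q.1 ∧ cellKey a p ≤ cellKey a q) ∨ CrossLT a h p q

/-- The conjugate order of the caterpillar poset. -/
def CoCellLE (a h : ℕ) (p q : ℕ × ℕ) : Prop :=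
  p = q ∨ (q.1 < p.1 ∧ ¬ CrossLT a h p q)

theorem cellKey_inj {a h : ℕ} {e : ℕ → ℕ} {p q : ℕ × ℕ} (hp : IsCell a h e p)
    (hq : IsCell a h e q) (h1 : p.1 = q.1) (h2 : cellKey a p = cellKey a q) : p = q := by
  obtain ⟨m, j⟩ := p
  obtain ⟨m', j'⟩ := q
  simp only [IsCell, cellKey] at *
  grind

/-- A graph whose vertices are labelled by the cells, adjacent when comparable. -/
structure IsCaterpillarGraph {V : Type*} (a h : ℕ) (e : ℕ → ℕ) (φ : V → ℕ × ℕ)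
    (H : SimpleGraph V) : Prop where
  inj : Function.Injective φ
  isCell : ∀ v, IsCell a h e (φ v)
  surj : ∀ p, IsCell a h e p → ∃ v, φ v = p
  adj : ∀ v w, H.Adj v w ↔ v ≠ w ∧ (CellLE a h (φ v) (φ w) ∨ CellLE a h (φ w) (φ v))
  bound : h = 0 ∧ a ≤ 2 ∨ a = h + 2
  anti : ∀ i j, i ≤ j → j < a → e j ≤ e i

namespace IsCaterpillarGraph

variable {V : Type*} {a h : ℕ} {e : ℕ → ℕ} {φ : V → ℕ × ℕ} {H : SimpleGraph V}

theorem isComparabilityGraph (hH : IsCaterpillarGraph a h e φ H) : IsComparabilityGraph H := by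
  refine ⟨fun v w => CellLE a h (φ v) (φ w), ?_, hH.adj⟩
  refine { refl := fun v => .inl ⟨rfl, le_rfl⟩, trans := ?_, antisymm := ?_ }
  · intro u v w
    simp only [CellLE, CrossLT]
    omega
  · intro v w h1 h2
    simp only [CellLE, CrossLT] at h1 h2
    exact hH.inj (cellKey_inj (hH.isCell v) (hH.isCell w) (by omega) (by omega))

theorem isComparabilityGraph_compl (hH : IsCaterpillarGraph a h e φ H) :
    IsComparabilityGraph Hᶜ := by
  refine ⟨fun v w => CoCellLE a h (φ v) (φ w), ?_, fun v w => ?_⟩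
  · refine { refl := fun v => .inl rfl, trans := ?_, antisymm := ?_ }
    · intro u v w
      have h1 := hH.isCell u
      have h2 := hH.isCell v
      have h3 := hH.isCell w
      simp only [CoCellLE, CrossLT]
      rintro (huv | huv) (hvw | hvw)
      · exact .inl (huv.trans hvw)
      · rw [huv]; exact .inr hvw
      · rw [← hvw]; exact .inr huv
      · right
        simp only [IsCell, cellKey] at *
        grind
    · rintro v w (h1 | h1) (h2 | h2)
      · exact hH.inj h1
      · exact hH.inj h1
      · exact hH.inj h2.symm
      · omega
  · rw [SimpleGraph.compl_adj, hH.adj]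
    simp only [CoCellLE, CellLE, hH.inj.eq_iff, CrossLT]
    grind

theorem color_ne (hH : IsCaterpillarGraph a h e φ H) (v w : V) (hvw : H.Adj v w) :
    (φ v).2 ≠ (φ w).2 := by
  intro heq
  obtain ⟨hne, hvw⟩ := (hH.adj v w).mp hvw
  have h1 := hH.isCell v
  have h2 := hH.isCell w
  have h3 : φ v ≠ φ w := hH.inj.ne hne
  revert h1 h2 h3 heq hvw
  generalize φ v = p
  generalize φ w = q
  obtain ⟨m, j⟩ := p
  obtain ⟨m', j'⟩ := q
  simp only [CellLE, CrossLT, IsCell, cellKey]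
  grind

/-- The class of a cell in the `k`-saturated partition: the level, except that one chain runs
along the spine through the levels below `k - 1`. -/
def cellClass (h k : ℕ) (p : ℕ × ℕ) : Option ℕ :=
  if p.1 < h ∧ p.1 + 2 ≤ k ∧ (p.2 = p.1 + 2 ∨ (p.1 + 2 = k ∧ p.2 = 0) ∨ (p.1 = 0 ∧ p.2 = 1))
  then none else some p.1

theorem isRainbowPartition (hH : IsCaterpillarGraph a h e φ H) (k : ℕ) :
    IsRainbowPartition H (fun v => (φ v).2) k (fun v => cellClass h k (φ v)) := by
  constructor
  · intro v w hvw hne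
    refine (hH.adj v w).mpr ⟨hne, ?_⟩
    have h1 := hH.isCell v
    have h2 := hH.isCell w
    revert h1 h2 hvw
    generalize φ v = p
    generalize φ w = q
    obtain ⟨m, j⟩ := p
    obtain ⟨m', j'⟩ := q
    by_cases hm : m = m'
    · intro _ _ _
      simp only [CellLE]
      omega
    · intro hvw h1 h2
      simp only [IsCell] at h1 h2
      simp only [cellClass] at hvw
      split_ifs at hvw with c1 c2
      · have hkey : ∀ n i, i < a → i = n + 2 ∨ i = 0 ∨ i = 1 → 1 ≤ cellKey a (n, i) ∨ i = 0 := by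
          intro n i _ _
          simp only [cellKey]
          split_ifs <;> omega
        have hkey' : ∀ n i, i = n + 2 ∨ i = 0 → cellKey a (n, i) ≤ 1 := by
          intro n i _
          simp only [cellKey]
          split_ifs <;> omega
        have := hkey m j h1.1 (by omega)
        have := hkey m' j' h2.1 (by omega)
        have := hkey' m j
        have := hkey' m' j'
        simp only [CellLE, CrossLT]
        omega
      · exact absurd (Option.some.inj hvw) hm
  · intro v hv j hj
    suffices ∃ p, IsCell a h e p ∧ cellClass h k p = cellClass h k (φ v) ∧ p.2 = j by
      obtain ⟨p, hp, h1, h2⟩ := this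
      obtain ⟨w, rfl⟩ := hH.surj p hp
      exact ⟨w, h1, h2⟩
    have h1 := hH.isCell v
    revert h1 hv
    generalize φ v = p
    obtain ⟨m, i⟩ := p
    intro hv h1
    have hb := hH.bound
    have hanti := hH.anti j i
    simp only [IsCell] at *
    by_cases hc : m < h ∧ m + 2 ≤ k ∧ (i = m + 2 ∨ (m + 2 = k ∧ i = 0) ∨ (m = 0 ∧ i = 1))
    · refine ⟨(if j = 0 then k - 2 else j - 2, j), ?_⟩
      simp only [cellClass]
      split_ifs <;> grind
    · refine ⟨(m, j), ?_⟩
      simp only [cellClass]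
      grind

theorem alphak_eq [Fintype V] (hH : IsCaterpillarGraph a h e φ H) (k : ℕ) :
    alphak H k = {v | (φ v).2 < k}.ncard :=
  (hH.isRainbowPartition k).alphak_eq hH.color_ne

theorem cliqueNumber_eq [Fintype V] (hH : IsCaterpillarGraph a h e φ H)
    (hv : ∃ v, (φ v).2 = a - 1) : cliqueNumber H = a :=
  (hH.isRainbowPartition (a - 1)).cliqueNumber_eq hH.color_ne (fun v => (hH.isCell v).1) hv

/-- In a `k`-saturated partition, the class of a spine element at a level `≥ k` contains the foot
of that level and stays in that level. -/
theorem class_spine_subset_level (hH : IsCaterpillarGraph a h e φ H) {k : ℕ} (hk : 0 < k)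
    {f : V → V} (hf : IsRainbowPartition H (fun v => (φ v).2) k f) (m : ℕ) (hkm : k ≤ m)
    (hmh : m < h) (v : V) (hv : φ v = (m, m + 2)) :
    (∃ w, φ w = (m, 0) ∧ f w = f v) ∧ ∀ w, f w = f v → (φ w).1 = m := by
  have hb := hH.bound
  induction hn : h - m using Nat.strong_induction_on generalizing m v with
  | _ n ih =>
    have hcmp : ∀ u w, f u = f w → u = w ∨ CellLE a h (φ u) (φ w) ∨ CellLE a h (φ w) (φ u) := by
      intro u w huw
      by_cases hne : u = w
      · exact .inl hne
      · exact .inr ((hH.adj u w).mp (hf.isClique u w huw hne)).2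
    -- The class of an element of level `m` with a foot in level `m' > m` is excluded.
    have hfoot : ∀ x, (φ x).1 = m → k ≤ (φ x).2 → ∃ w, φ w = (m, 0) ∧ f w = f x := by
      intro x hx hkx
      obtain ⟨w, hwx, hw0⟩ := hf.rainbow x hkx 0 hk
      have hw0 : (φ w).2 = 0 := hw0
      suffices (φ w).1 = m from ⟨w, Prod.ext this hw0, hwx⟩
      by_contra hne
      have hlt : m < (φ w).1 ∧ (φ w).1 < h := by
        have hkey : cellKey a (φ w) = 0 := by simp [cellKey, hw0]
        rcases hcmp w x hwx with rfl | hc | hc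
        · exact absurd hx hne
        · simp only [CellLE, CrossLT] at hc
          omega
        · simp only [CellLE, CrossLT] at hc
          omega
      obtain ⟨c, hc⟩ := hH.surj ((φ w).1, (φ w).1 + 2)
        ⟨show (φ w).1 + 2 < a by omega, .inl ⟨hlt.2, .inr (.inr rfl)⟩⟩
      obtain ⟨⟨w', hw', hw'c⟩, hlev⟩ := ih (h - (φ w).1) (by omega) (φ w).1 (by omega) hlt.2 c hc rfl
      have : w' = w := hH.inj (hw'.trans (Prod.ext rfl hw0.symm))
      subst this
      have := hlev x (hwx.symm.trans hw'c)
      omega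
    obtain ⟨d, hd, hdv⟩ := hfoot v (by rw [hv]) (by rw [hv]; simp only; omega)
    refine ⟨⟨d, hd, hdv⟩, fun w hw => ?_⟩
    obtain ⟨t, ht⟩ := hH.surj (m, m) (by simp only [IsCell]; omega)
    obtain ⟨d', hd', hd't⟩ := hfoot t (by rw [ht]) (by rw [ht]; exact hkm)
    have hdd : d' = d := hH.inj (hd'.trans hd.symm)
    subst hdd
    have c1 := hcmp w d' (hw.trans hdv.symm)
    have c2 := hcmp w t ((hw.trans hdv.symm).trans hd't)
    rcases c1 with rfl | c1
    · rw [hd]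
    rcases c2 with rfl | c2
    · rw [ht]
    have k1 : cellKey a (m, 0) = 0 := by simp [cellKey]
    have k2 : 2 ≤ cellKey a (m, m) := by
      simp only [cellKey]
      grind
    rw [hd] at c1
    rw [ht] at c2
    simp only [CellLE, CrossLT] at c1 c2
    omega

theorem polyunsatG [Fintype V] (hH : IsCaterpillarGraph a h e φ H)
    (hv : ∃ v, (φ v).2 = a - 1) : PolyunsatG H := by
  have key : ∀ k l, 0 < k → l < a → k + 2 ≤ l →
      ¬ ∃ f : V → V, IsCliquePartition H f ∧ knorm f k = alphak H k ∧ knorm f l = alphak H l := by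
    rintro k l hk hl hkl ⟨f, hf, h1, h2⟩
    rw [hH.alphak_eq] at h1 h2
    have r1 := isRainbowPartition_of_saturated hH.color_ne hf h1
    have r2 := isRainbowPartition_of_saturated hH.color_ne hf h2
    have hb := hH.bound
    obtain ⟨v, hv⟩ := hH.surj (l - 2, l - 2 + 2)
      ⟨show l - 2 + 2 < a by omega, .inl ⟨show l - 2 < h by omega, .inr (.inr rfl)⟩⟩
    have hlev := (hH.class_spine_subset_level hk r1 (l - 2) (by omega) (by omega) v hv).2
    obtain ⟨w, hw, hw'⟩ := r2.rainbow v (by rw [hv]; simp only; omega) (l - 1) (by omega)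
    have hc := hH.isCell w
    have := hlev w hw
    simp only [IsCell] at hc
    omega
  intro k l hk hl hka hla hkl
  rw [hH.cliqueNumber_eq hv] at hka hla
  rcases hkl with hkl | hkl
  · exact key k l hk hla hkl
  · rintro ⟨f, hf, h1, h2⟩
    exact key l k hl hka hkl ⟨f, hf, h2, h1⟩

theorem ncard_color [Finite V] (hH : IsCaterpillarGraph a h e φ H) {j : ℕ} (hj : j < a) :
    {v | (φ v).2 = j}.ncard = e j + if j ≤ 1 then h else h - min j h + 1 := by
  have hb := hH.bound
  have hinj : Set.InjOn (fun v => (φ v).1) {v | (φ v).2 = j} := fun v hv w hw hvw =>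
    hH.inj (Prod.ext hvw (Eq.trans hv (Eq.symm hw)))
  rw [← hinj.ncard_image]
  have himg : (fun v => (φ v).1) '' {v | (φ v).2 = j} = {m | IsCell a h e (m, j)} := by
    ext m
    constructor
    · rintro ⟨v, rfl, rfl⟩
      exact hH.isCell v
    · intro hm
      obtain ⟨v, hv⟩ := hH.surj _ hm
      exact ⟨v, by simp [hv], by simp [hv]⟩
  rw [himg]
  split_ifs with h1
  · have : {m | IsCell a h e (m, j)} = ↑(Finset.range (h + e j)) := by
      ext m
      simp only [IsCell, Set.mem_ofPred_eq, Finset.coe_range, Set.mem_Iio]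
      omega
    rw [this, Set.ncard_coe_finset, Finset.card_range]
    omega
  · have : {m | IsCell a h e (m, j)} = ↑(insert (j - 2) (Finset.Ico (min j h) (h + e j))) := by
      ext m
      simp only [IsCell, Set.mem_ofPred_eq, Finset.coe_insert, Finset.coe_Ico, Set.mem_insert_iff,
        Set.mem_Ico]
      omega
    rw [this, Set.ncard_coe_finset, Finset.card_insert_of_notMem (by simp; omega), Nat.card_Ico]
    omega

theorem alphak_succ [Fintype V] (hH : IsCaterpillarGraph a h e φ H) {k : ℕ} (hk : k < a) :
    alphak H (k + 1) = alphak H k + (e k + if k ≤ 1 then h else h - min k h + 1) := by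
  rw [hH.alphak_eq, hH.alphak_eq, ← hH.ncard_color hk, ← Set.ncard_union_eq]
  · congr 1
    ext v
    simp only [Set.mem_ofPred_eq, Set.mem_union]
    omega
  · rw [Set.disjoint_left]
    intro v (h1 : _ < k) (h2 : _ = k)
    omega

end IsCaterpillarGraph

theorem exists_isCaterpillarGraph {a h : ℕ} {e : ℕ → ℕ} (bound : h = 0 ∧ a ≤ 2 ∨ a = h + 2)
    (anti : ∀ i j, i ≤ j → j < a → e j ≤ e i) :
    ∃ (n : ℕ) (φ : Fin n → ℕ × ℕ) (H : SimpleGraph (Fin n)), IsCaterpillarGraph a h e φ H := by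
  have hfin : {p | IsCell a h e p}.Finite := by
    refine ((Finset.range (h + e 0)) ×ˢ (Finset.range a)).finite_toSet.subset ?_
    rintro ⟨m, j⟩ hp
    have hp : IsCell a h e (m, j) := hp
    have := anti 0 j (Nat.zero_le _)
    simp only [IsCell] at hp
    simp only [Finset.coe_product, Finset.coe_range, Set.mem_prod, Set.mem_Iio]
    omega
  let φ : Fin hfin.toFinset.card → ℕ × ℕ := fun i => hfin.toFinset.equivFin.symm i
  refine ⟨_, φ, { Adj := fun v w => v ≠ w ∧ (CellLE a h (φ v) (φ w) ∨ CellLE a h (φ w) (φ v))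
                  symm := ⟨fun v w hvw => ⟨hvw.1.symm, hvw.2.symm⟩⟩
                  loopless := ⟨fun v hv => hv.1 rfl⟩ }, ?_⟩
  refine ⟨?_, fun v => ?_, fun p hp => ?_, fun _ _ => Iff.rfl, bound, anti⟩
  · exact Subtype.val_injective.comp (Equiv.injective _)
  · exact hfin.mem_toFinset.mp (hfin.toFinset.equivFin.symm v).2
  · exact ⟨hfin.toFinset.equivFin ⟨p, by simpa using hp⟩, by simp [φ]⟩

/-- For a positive integer `a` and a nonincreasing sequence `b 1 ≥ … ≥ b a` of positive
integers: there exists a co-polyunsaturated SGK graph `G` with independence number `a`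
and `Δω_k(G) = b k` for `k = 1, …, a` iff `b 2 > b 3 > … > b (a-1)`; moreover, in that
case `G` may be chosen so that it and its complement are comparability graphs. -/
theorem statement15 (a : ℕ) (ha : 0 < a) (b : ℕ → ℕ)
    (hpos : ∀ k, 1 ≤ k → k ≤ a → 0 < b k)
    (hmono : ∀ k l, 1 ≤ k → k ≤ l → l ≤ a → b l ≤ b k) :
    ((∃ (n : ℕ) (G : SimpleGraph (Fin n)),
        SGK G ∧ SGK Gᶜ ∧ PolyunsatG Gᶜ ∧ indepNumber G = a ∧
        (∀ k, 1 ≤ k → k ≤ a → omegak G k = omegak G (k - 1) + b k)) ↔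
      (∀ k, 2 ≤ k → k + 2 ≤ a → b (k + 1) < b k)) ∧
    ((∀ k, 2 ≤ k → k + 2 ≤ a → b (k + 1) < b k) →
      ∃ (n : ℕ) (G : SimpleGraph (Fin n)),
        SGK G ∧ SGK Gᶜ ∧ PolyunsatG Gᶜ ∧ indepNumber G = a ∧
        (∀ k, 1 ≤ k → k ≤ a → omegak G k = omegak G (k - 1) + b k) ∧
        IsComparabilityGraph G ∧ IsComparabilityGraph Gᶜ) := by
  have hex : (∀ k, 2 ≤ k → k + 2 ≤ a → b (k + 1) < b k) →
      ∃ (n : ℕ) (G : SimpleGraph (Fin n)),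
        SGK G ∧ SGK Gᶜ ∧ PolyunsatG Gᶜ ∧ indepNumber G = a ∧
        (∀ k, 1 ≤ k → k ≤ a → omegak G k = omegak G (k - 1) + b k) ∧
        IsComparabilityGraph G ∧ IsComparabilityGraph Gᶜ := by
    intro hdec
    obtain ⟨h, hh⟩ : ∃ h, h = a - 2 := ⟨_, rfl⟩
    have bound : h = 0 ∧ a ≤ 2 ∨ a = h + 2 := by omega
    obtain ⟨c, hc⟩ : ∃ c : ℕ → ℕ, ∀ j, c j = if j ≤ 1 then h else h - min j h + 1 := ⟨_, fun _ => rfl⟩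
    have hstep : ∀ j, j + 1 < a → b (j + 2) + c j ≤ b (j + 1) + c (j + 1) := by
      intro j hj
      have h1 := hmono (j + 1) (j + 2) (by omega) (by omega) (by omega)
      have h2 := hdec (j + 1)
      rw [hc, hc]
      split_ifs <;> grind
    have hge : ∀ d j, j + d + 1 = a → c j ≤ b (j + 1) := by
      intro d
      induction d with
      | zero =>
        intro j hj
        have := hpos (j + 1) (by omega) (by omega)
        rw [hc]
        split_ifs <;> omega
      | succ d ih =>
        intro j hj
        have h1 := ih (j + 1) (by omega)
        have h2 := hstep j (by omega)
        have : b (j + 1 + 1) = b (j + 2) := rfl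
        omega
    have hge' : ∀ j, j < a → c j ≤ b (j + 1) := fun j hj => hge (a - 1 - j) j (by omega)
    have anti : ∀ i j, i ≤ j → j < a → b (j + 1) - c j ≤ b (i + 1) - c i := by
      intro i j hij
      induction j, hij using Nat.le_induction with
      | base => exact fun _ => le_rfl
      | succ j hij ih =>
        intro hj
        have h1 := ih (by omega)
        have h2 := hstep j hj
        have h3 := hge' j (by omega)
        have : b (j + 1 + 1) = b (j + 2) := rfl
        omega
    obtain ⟨n, φ, H, hH⟩ := exists_isCaterpillarGraph (e := fun j => b (j + 1) - c j) bound anti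
    have hsucc : ∀ k, k < a → alphak H (k + 1) = alphak H k + b (k + 1) := by
      intro k hk
      have := hge' k hk
      rw [hH.alphak_succ hk, ← hc]
      omega
    have hv : ∃ v, (φ v).2 = a - 1 := by
      have h1 := hsucc (a - 1) (by omega)
      have h2 := hpos (a - 1 + 1) (by omega) (by omega)
      rw [hH.alphak_eq, hH.alphak_eq] at h1
      by_contra! hne
      have : {v | (φ v).2 < a - 1 + 1} = {v | (φ v).2 < a - 1} := by
        ext v
        have := hne v
        simp only [Set.mem_ofPred_eq]
        omega
      rw [this] at h1
      omega
    refine ⟨n, Hᶜ, hH.isComparabilityGraph_compl.sgk, ?_, ?_, ?_, fun k hk hka => ?_,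
      hH.isComparabilityGraph_compl, ?_⟩
    · rw [compl_compl]; exact hH.isComparabilityGraph.sgk
    · rw [compl_compl]; exact hH.polyunsatG hv
    · rw [← cliqueNumber_compl, compl_compl]; exact hH.cliqueNumber_eq hv
    · rw [← alphak_compl, ← alphak_compl, compl_compl]
      obtain ⟨k, rfl⟩ := Nat.exists_eq_add_of_le' hk
      exact hsucc k hka
    · rw [compl_compl]; exact hH.isComparabilityGraph
  refine ⟨⟨?_, fun hdec => ?_⟩, hex⟩
  · rintro ⟨n, G, -, hG, hpoly, hind, homega⟩ k hk hka
    obtain ⟨k, rfl⟩ := Nat.exists_eq_add_of_le' (show 1 ≤ k by omega)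
    refine lt_of_polyunsatG hG hpoly (k := k) (by omega) ?_ ?_ ?_
    · rw [cliqueNumber_compl]; omega
    · rw [alphak_compl, alphak_compl]; exact homega (k + 1) (by omega) (by omega)
    · rw [alphak_compl, alphak_compl]; exact homega (k + 2) (by omega) (by omega)
  · obtain ⟨n, G, h1, h2, h3, h4, h5, -, -⟩ := hex hdec
    exact ⟨n, G, h1, h2, h3, h4, h5⟩
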